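/- arXiv:0911.3173 — 2 statements merged into one kernel-verified Lean document; each statement's English description precedes it below -/
import Mathlib

section
/- Assume that G admits a JSJ tree over 𝒜. Then for every 𝒜-tree T whose edge stabilizers are all universally elliptic, there exist a JSJ tree T̂ of G over 𝒜 and a collapse map T̂ → T; that is, T may be refined to a JSJ tree. -/
universe u v

/-- A `G`-tree: a nonempty simple graph which is a tree (connected and acyclic),
with a minimal action of `G` by graph automorphisms without inversions. -/
structure GTree (G : Type u) [Group G] : Type (u + 1) where
  V : Type u
  graph : SimpleGraph V
  nonempty : Nonempty V
  connected : graph.Connected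
  acyclic : graph.IsAcyclic
  act : G → V → V
  act_one : ∀ w, act 1 w = w
  act_mul : ∀ g h w, act (g * h) w = act g (act h w)
  act_adj : ∀ g a b, graph.Adj a b → graph.Adj (act g a) (act g b)
  noInversion : ∀ g a b, graph.Adj a b → ¬(act g a = b ∧ act g b = a)
  minimal : ∀ S : Set V, S.Nonempty → (∀ g, ∀ w ∈ S, act g w ∈ S) →
    (graph.induce S).Connected → S = Set.univ

namespace GTree

variable {G : Type u} [Group G]

/-- The stabilizer of a vertex. -/
def vertexStab (T : GTree G) (w : T.V) : Subgroup G where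
  carrier := {g | T.act g w = w}
  one_mem' := T.act_one w
  mul_mem' := by
    intro a b ha hb
    simp only [Set.mem_setOf_eq] at *
    rw [T.act_mul, hb, ha]
  inv_mem' := by
    intro a ha
    simp only [Set.mem_setOf_eq] at *
    calc T.act a⁻¹ w = T.act a⁻¹ (T.act a w) := by rw [ha]
    _ = T.act (a⁻¹ * a) w := (T.act_mul _ _ _).symm
    _ = w := by rw [inv_mul_cancel, T.act_one]

/-- The stabilizer of an edge `{u,v}`: elements fixing both endpoints. -/
def edgeStab (T : GTree G) (a b : T.V) : Subgroup G :=
  T.vertexStab a ⊓ T.vertexStab b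

/-- A subgroup is elliptic in `T` if it fixes a vertex. -/
def EllipticSubgroup (T : GTree G) (H : Subgroup G) : Prop :=
  ∃ w : T.V, ∀ h ∈ H, T.act h w = w

/-- An element is elliptic in `T` if it fixes a vertex (otherwise it is hyperbolic). -/
def EllipticElt (T : GTree G) (g : G) : Prop :=
  ∃ w : T.V, T.act g w = w

/-- `T₁` dominates `T₂`: every subgroup elliptic in `T₁` is elliptic in `T₂`. -/
def Dominates (T₁ T₂ : GTree G) : Prop :=
  ∀ H : Subgroup G, T₁.EllipticSubgroup H → T₂.EllipticSubgroup H

/-- `T` is an `𝒜`-tree: all its edge stabilizers belong to `𝒜`. -/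
def IsATree (T : GTree G) (𝒜 : Set (Subgroup G)) : Prop :=
  ∀ a b : T.V, T.graph.Adj a b → T.edgeStab a b ∈ 𝒜

/-- A subgroup is universally elliptic if it is elliptic in every `𝒜`-tree. -/
def UnivEllipticSubgroup (𝒜 : Set (Subgroup G)) (H : Subgroup G) : Prop :=
  ∀ T : GTree G, T.IsATree 𝒜 → T.EllipticSubgroup H

/-- An `𝒜`-tree is universally elliptic if all its edge stabilizers are universally elliptic. -/
def UnivEllipticTree (T : GTree G) (𝒜 : Set (Subgroup G)) : Prop :=
  ∀ a b : T.V, T.graph.Adj a b → UnivEllipticSubgroup 𝒜 (T.edgeStab a b)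

/-- A JSJ tree of `G` over `𝒜`: a universally elliptic `𝒜`-tree dominating every
universally elliptic `𝒜`-tree. -/
def IsJSJ (T : GTree G) (𝒜 : Set (Subgroup G)) : Prop :=
  T.IsATree 𝒜 ∧ T.UnivEllipticTree 𝒜 ∧
    ∀ T' : GTree G, T'.IsATree 𝒜 → T'.UnivEllipticTree 𝒜 → T.Dominates T'

/-- A collapse map `T → T'`: a `G`-equivariant surjection on vertices sending adjacent
vertices to adjacent or equal vertices, with connected point preimages. -/
def IsCollapseMap (T T' : GTree G) (f : T.V → T'.V) : Prop :=
  (∀ g w, f (T.act g w) = T'.act g (f w)) ∧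
    Function.Surjective f ∧
    (∀ a b : T.V, T.graph.Adj a b → f a = f b ∨ T'.graph.Adj (f a) (f b)) ∧
    ∀ w : T'.V, (T.graph.induce (f ⁻¹' {w})).Connected

end GTree

/-- `𝒜` is closed under conjugation and under passing to subgroups. -/
def ClosedFamily {G : Type u} [Group G] (𝒜 : Set (Subgroup G)) : Prop :=
  (∀ H ∈ 𝒜, ∀ g : G, Subgroup.map (MulAut.conj g).toMonoidHom H ∈ 𝒜) ∧
    ∀ H ∈ 𝒜, ∀ K : Subgroup G, K ≤ H → K ∈ 𝒜

/-- `G` is finitely presented: it admits a presentation with finitely many generators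
and finitely many relations. -/
def FinitelyPresentedGroup (G : Type u) [Group G] : Prop :=
  ∃ (n : ℕ) (rels : Set (FreeGroup (Fin n))),
    rels.Finite ∧ Nonempty (PresentedGroup rels ≃* G)

/-- `T` is an `(𝒜,ℋ)`-tree: an `𝒜`-tree in which every subgroup in `ℋ` is elliptic. -/
def RelATree {G : Type u} [Group G] (𝒜 ℋ : Set (Subgroup G)) (T : GTree G) : Prop :=
  T.IsATree 𝒜 ∧ ∀ H ∈ ℋ, T.EllipticSubgroup H

/-- A subgroup is universally elliptic relative to `ℋ` if it is elliptic in every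
`(𝒜,ℋ)`-tree. -/
def RelUnivEllipticSubgroup {G : Type u} [Group G] (𝒜 ℋ : Set (Subgroup G))
    (K : Subgroup G) : Prop :=
  ∀ T : GTree G, RelATree 𝒜 ℋ T → T.EllipticSubgroup K

/-- An `(𝒜,ℋ)`-tree is universally elliptic if all its edge stabilizers are universally
elliptic relative to `ℋ`. -/
def RelUnivEllipticTree {G : Type u} [Group G] (𝒜 ℋ : Set (Subgroup G))
    (T : GTree G) : Prop :=
  ∀ a b : T.V, T.graph.Adj a b → RelUnivEllipticSubgroup 𝒜 ℋ (T.edgeStab a b)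

/-- A JSJ tree of `G` over `𝒜` relative to `ℋ`. -/
def IsRelJSJ {G : Type u} [Group G] (𝒜 ℋ : Set (Subgroup G)) (T : GTree G) : Prop :=
  RelATree 𝒜 ℋ T ∧ RelUnivEllipticTree 𝒜 ℋ T ∧
    ∀ T' : GTree G, RelATree 𝒜 ℋ T' → RelUnivEllipticTree 𝒜 ℋ T' → T.Dominates T'

/-- The family of groups `F, H₁, …, H_p` whose free product is used to define relative
finite presentability. -/
def relFam {G : Type u} [Group G] {p : ℕ} (H : Fin p → Subgroup G) (n : ℕ) :
    Option (Fin p) → Type u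
  | none => FreeGroup (ULift.{u} (Fin n))
  | some j => H j

instance relFamGroup {G : Type u} [Group G] {p : ℕ} (H : Fin p → Subgroup G) (n : ℕ) :
    (i : Option (Fin p)) → Group (relFam H n i)
  | none => inferInstanceAs (Group (FreeGroup _))
  | some j => inferInstanceAs (Group (H j))

/-- `G` is finitely presented relative to `H₁, …, H_p`: there is a surjection from
`F ∗ H₁ ∗ ⋯ ∗ H_p` (with `F` a finitely generated free group) onto `G` restricting to
the inclusion on each `Hᵢ`, whose kernel is the normal closure of a finite subset. -/
def RelFinitelyPresented {G : Type u} [Group G] {p : ℕ} (H : Fin p → Subgroup G) : Prop :=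
  ∃ (n : ℕ) (φ : Monoid.CoprodI (relFam H n) →* G),
    Function.Surjective φ ∧
    (∀ (j : Fin p) (h : H j), φ (Monoid.CoprodI.of (M := relFam H n) (i := some j) h) = (h : G)) ∧
    ∃ s : Set (Monoid.CoprodI (relFam H n)), s.Finite ∧
      MonoidHom.ker φ = Subgroup.normalClosure s

/-- `S` has a single orbit of edges. -/
def OneEdgeOrbit {G : Type u} [Group G] (S : GTree G) : Prop :=
  ∀ e₁ ∈ S.graph.edgeSet, ∀ e₂ ∈ S.graph.edgeSet, ∃ g : G, Sym2.map (S.act g) e₁ = e₂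

/-- `G` splits over `K`: there is a nontrivial `G`-tree with a single orbit of edges
having `K` as an edge stabilizer. -/
def SplitsOver {G : Type u} [Group G] (K : Subgroup G) : Prop :=
  ∃ S : GTree G, Nontrivial S.V ∧ OneEdgeOrbit S ∧
    ∃ x y : S.V, S.graph.Adj x y ∧ S.edgeStab x y = K

/-- A subgroup is slender if all its subgroups are finitely generated. -/
def SlenderSubgroup {G : Type u} [Group G] (H : Subgroup G) : Prop :=
  ∀ K : Subgroup G, K ≤ H → K.FG

/-- A subgroup is abelian. -/
def AbelianSubgroup {G : Type u} [Group G] (H : Subgroup G) : Prop :=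
  ∀ a ∈ H, ∀ b ∈ H, a * b = b * a

/-- `H` is malnormal in `G`: `gHg⁻¹ ∩ H ≠ {1}` implies `g ∈ H`. -/
def Malnormal {G : Type u} [Group G] (H : Subgroup G) : Prop :=
  ∀ g : G, (∃ x ∈ H, x ≠ 1 ∧ g * x * g⁻¹ ∈ H) → g ∈ H

/-- `G` is CSA: the centralizer of every nontrivial element is abelian and malnormal. -/
def IsCSA (G : Type u) [Group G] : Prop :=
  ∀ g : G, g ≠ 1 →
    AbelianSubgroup (Subgroup.centralizer {g}) ∧ Malnormal (Subgroup.centralizer {g})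

/-- A map sending adjacent vertices to adjacent or equal vertices preserves reachability. -/
theorem SimpleGraph.Reachable.map_of_adj_or_eq {V : Type*} {W : Type*} {Γ : SimpleGraph V}
    {Δ : SimpleGraph W} (f : V → W) (hf : ∀ a b, Γ.Adj a b → f a = f b ∨ Δ.Adj (f a) (f b))
    {a b : V} (h : Γ.Reachable a b) : Δ.Reachable (f a) (f b) := by
  obtain ⟨p⟩ := h
  induction p with
  | nil => exact .refl _
  | cons hadj _ ih =>
    rcases hf _ _ hadj with h | h
    · rwa [h]
    · exact h.reachable.trans ih

/-- The image of a set spanning a connected subgraph under a map sending adjacent vertices to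
adjacent or equal vertices spans a connected subgraph. -/
theorem SimpleGraph.Connected.induce_image {V : Type*} {W : Type*} {Γ : SimpleGraph V}
    {Δ : SimpleGraph W} (f : V → W) (hf : ∀ a b, Γ.Adj a b → f a = f b ∨ Δ.Adj (f a) (f b))
    {s : Set V} (hs : (Γ.induce s).Connected) : (Δ.induce (f '' s)).Connected := by
  let F : s → f '' s := fun x => ⟨f x, x, x.2, rfl⟩
  have hF : ∀ a b, (Γ.induce s).Adj a b → F a = F b ∨ (Δ.induce (f '' s)).Adj (F a) (F b) :=
    fun a b h => (hf a b h).imp (fun h => Subtype.ext h) id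
  have : Nonempty (f '' s) := hs.nonempty.map F
  refine ⟨?_⟩
  rintro ⟨_, x, hx, rfl⟩ ⟨_, y, hy, rfl⟩
  exact (hs.preconnected ⟨x, hx⟩ ⟨y, hy⟩).map_of_adj_or_eq F hF

/-- In a forest, the intersection of two sets spanning connected subgraphs spans a
preconnected subgraph. -/
theorem SimpleGraph.IsAcyclic.preconnected_induce_inter {V : Type*} {Γ : SimpleGraph V}
    (hΓ : Γ.IsAcyclic) {s t : Set V} (hs : (Γ.induce s).Preconnected)
    (ht : (Γ.induce t).Preconnected) : (Γ.induce (s ∩ t)).Preconnected := by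
  classical
  have key : ∀ r : Set V, (Γ.induce r).Preconnected → ∀ a b, a ∈ r → b ∈ r →
      ∃ p : Γ.Path a b, ∀ x ∈ p.1.support, x ∈ r := by
    intro r hr a b ha hb
    obtain ⟨p⟩ := hr ⟨a, ha⟩ ⟨b, hb⟩
    let φ : Γ.induce r →g Γ := ⟨Subtype.val, id⟩
    refine ⟨(p.map φ).toPath, fun x hx => ?_⟩
    have hx' := SimpleGraph.Walk.support_toPath_subset_support _ hx
    rw [SimpleGraph.Walk.support_map, List.mem_map] at hx'
    obtain ⟨y, -, rfl⟩ := hx'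
    exact y.2
  rintro ⟨a, ha⟩ ⟨b, hb⟩
  obtain ⟨p, hp⟩ := key s hs a b ha.1 hb.1
  obtain ⟨q, hq⟩ := key t ht a b ha.2 hb.2
  obtain rfl := (hΓ.subsingleton_path a b).elim p q
  exact ⟨p.1.induce (s ∩ t) fun x hx => ⟨hp x hx, hq x hx⟩⟩

/-- In a tree with base vertex `v`, one can assign to each vertex the first vertex after `v` on
the geodesic towards it. -/
theorem SimpleGraph.IsTree.exists_branch {V : Type*} {Γ : SimpleGraph V} (hΓ : Γ.IsTree) (v : V) :
    ∃ β : V → V, (∀ w, Γ.Adj v w → β w = w) ∧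
      ∀ w w', w ≠ v → w' ≠ v → Γ.Adj w w' → β w = β w' := by
  choose p hp _ using hΓ.existsUnique_path v
  have concat_snd : ∀ {w w' : V} (h : Γ.Adj w w'), w ≠ v → ((p w).concat h).snd = (p w).snd := by
    intro w w' h hw
    cases hq : p w with
    | nil => exact absurd rfl hw
    | cons hadj q => simp [SimpleGraph.Walk.concat_cons]
  refine ⟨fun w => (p w).snd, fun w h => ?_, fun w w' hw hw' h => ?_⟩
  · have hnil : (SimpleGraph.Walk.cons h .nil).IsPath := by simpa using h.ne
    have := congrArg Subtype.val <|
      (hΓ.isAcyclic.subsingleton_path v w).elim ⟨p w, hp w⟩ ⟨_, hnil⟩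
    simp only at this
    simp [this]
  · by_cases hmem : w ∈ (p w').support
    · simp only [hΓ.isAcyclic.path_concat (hp w) (hp w') h hmem, concat_snd h hw]
    · have := hΓ.isAcyclic.mem_support_of_ne_mem_support_of_adj_of_isPath (hp w) (hp w') h hmem
      simp only [hΓ.isAcyclic.path_concat (hp w') (hp w) h.symm this, concat_snd h.symm hw']

/-- The graph obtained from `Γ` by replacing every vertex by a copy of `Δ`, an edge `e` of `Γ`
being attached at both ends to the vertex `q e` of `Δ`. -/
def SimpleGraph.blowup {V : Type*} {W : Type*} (Γ : SimpleGraph V) (Δ : SimpleGraph W)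
    (q : Sym2 V → W) : SimpleGraph (V × W) where
  Adj a b := (a.1 = b.1 ∧ Δ.Adj a.2 b.2) ∨
    (Γ.Adj a.1 b.1 ∧ a.2 = q s(a.1, b.1) ∧ b.2 = q s(a.1, b.1))
  symm := ⟨by
    rintro a b (⟨h, h'⟩ | ⟨h, h₁, h₂⟩)
    · exact .inl ⟨h.symm, h'.symm⟩
    · exact .inr ⟨h.symm, by rwa [Sym2.eq_swap], by rwa [Sym2.eq_swap]⟩⟩
  loopless := ⟨by
    rintro a (⟨-, h⟩ | ⟨h, -⟩)
    · exact h.ne rfl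
    · exact h.ne rfl⟩

namespace SimpleGraph

variable {V : Type*} {W : Type*} {Γ : SimpleGraph V} {Δ : SimpleGraph W} {q : Sym2 V → W}

theorem blowup_fst_adj_or_eq (a b : V × W) (h : (Γ.blowup Δ q).Adj a b) :
    a.1 = b.1 ∨ Γ.Adj a.1 b.1 :=
  h.imp (·.1) (·.1)

theorem blowup_fiber_reachable (hΔ : Δ.Connected) (v : V) (x y : W) :
    (Γ.blowup Δ q).Reachable (v, x) (v, y) :=
  (hΔ.preconnected x y).map_of_adj_or_eq (Prod.mk v) fun _ _ h => Or.inr (Or.inl ⟨rfl, h⟩)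

theorem blowup_induce_fiber_preconnected (hΔ : Δ.Connected) (v : V) :
    ((Γ.blowup Δ q).induce (Prod.fst ⁻¹' {v})).Preconnected := by
  rintro ⟨⟨a, x⟩, ha⟩ ⟨⟨b, y⟩, hb⟩
  have ha' : a = v := ha
  have hb' : b = v := hb
  subst ha' hb'
  exact (hΔ.preconnected x y).map_of_adj_or_eq
    (fun z => (⟨(b, z), rfl⟩ : Prod.fst ⁻¹' {b})) fun _ _ h => Or.inr (Or.inl ⟨rfl, h⟩)

theorem blowup_connected (hΓ : Γ.Connected) (hΔ : Δ.Connected) : (Γ.blowup Δ q).Connected := by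
  have := hΓ.nonempty
  have := hΔ.nonempty
  refine ⟨?_⟩
  rintro ⟨v, x⟩ ⟨w, y⟩
  obtain ⟨p⟩ := hΓ.preconnected v w
  induction p generalizing x with
  | nil => exact blowup_fiber_reachable hΔ _ _ _
  | @cons a b c h p ih =>
    exact (blowup_fiber_reachable hΔ a x (q s(a, b))).trans
      ((show (Γ.blowup Δ q).Adj (a, q s(a, b)) (b, q s(a, b)) from
        .inr ⟨h, rfl, rfl⟩).reachable.trans (ih _))

theorem blowup_isAcyclic (hΓ : Γ.IsTree) (hΔ : Δ.IsAcyclic) : (Γ.blowup Δ q).IsAcyclic := by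
  classical
  rw [isAcyclic_iff_forall_adj_isBridge] at hΔ ⊢
  rintro ⟨v, x⟩ ⟨w, y⟩ (⟨hvw, h⟩ | ⟨h, hx, hy⟩)
  · obtain rfl : v = w := hvw
    obtain ⟨β, hβ, hβ'⟩ := hΓ.exists_branch v
    let r : V × W → W := fun a => if a.1 = v then a.2 else q s(v, β a.1)
    intro hr
    have hrv : ∀ z, r (v, z) = z := fun z => if_pos rfl
    refine hΔ h ?_
    have := hr.map_of_adj_or_eq (Δ := Δ.deleteEdges {s(x, y)}) r ?_
    · rwa [hrv, hrv] at this
    rintro ⟨a, s⟩ ⟨b, t⟩ hab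
    rw [deleteEdges_adj] at hab
    obtain ⟨⟨hab', h'⟩ | ⟨h', hs, ht⟩, hne⟩ := hab
    · obtain rfl : a = b := hab'
      by_cases ha : a = v
      · subst ha
        right
        rw [hrv, hrv, deleteEdges_adj]
        refine ⟨h', fun hst => hne ?_⟩
        simp only [Set.mem_singleton_iff, Sym2.eq_iff, Prod.mk.injEq] at hst ⊢
        tauto
      · left
        simp [r, ha]
    · left
      simp only at h' hs ht
      by_cases ha : a = v
      · subst ha
        have hb : b ≠ a := h'.ne'
        simp [r, hb, hβ b h', hs]
      · by_cases hb : b = v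
        · subst hb
          simp [r, ha, hβ a h'.symm, ht, Sym2.eq_swap]
        · simp [r, ha, hb, hβ' a b ha hb h']
  · intro hr
    refine isAcyclic_iff_forall_adj_isBridge.1 hΓ.isAcyclic h ?_
    refine hr.map_of_adj_or_eq (Δ := Γ.deleteEdges {s(v, w)}) Prod.fst ?_
    rintro ⟨a, s⟩ ⟨b, t⟩ hab
    rw [deleteEdges_adj] at hab
    obtain ⟨⟨hab', h'⟩ | ⟨h', hs, ht⟩, hne⟩ := hab
    · exact .inl hab'
    · right
      rw [deleteEdges_adj]
      refine ⟨h', fun hst => hne ?_⟩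
      simp only [Set.mem_singleton_iff] at hst hx hy hs ht ⊢
      rw [hst] at hs ht
      subst hx hy hs ht
      simp only [Sym2.eq_iff, Prod.mk.injEq] at hst ⊢
      tauto

end SimpleGraph

/-- If the stabilizer of each point of an invariant set `s` has a fixed point in `X`, then there
is an equivariant map from `s` to `X`. -/
theorem MulAction.exists_equivariant_of_fixed {G : Type*} {E : Type*} {X : Type*} [Group G]
    [MulAction G E] [MulAction G X] [Nonempty X] (s : Set E) (hs : ∀ g : G, ∀ e ∈ s, g • e ∈ s)
    (hfix : ∀ e ∈ s, ∃ x : X, ∀ g : G, g • e = e → g • x = x) :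
    ∃ q : E → X, ∀ g : G, ∀ e ∈ s, q (g • e) = g • q e := by
  classical
  choose! x hx using hfix
  let r : E → E := fun e => (Quotient.mk (MulAction.orbitRel G E) e).out
  have hr : ∀ e, ∃ g : G, g • r e = e := fun e =>
    MulAction.orbitRel_apply.1 ((MulAction.orbitRel G E).symm (Quotient.mk_out e))
  choose γ hγ using hr
  refine ⟨fun e => γ e • x (r e), fun g e he => ?_⟩
  have hrg : r (g • e) = r e := by
    refine congrArg Quotient.out (Quotient.sound ?_)
    exact MulAction.orbitRel_apply.2 ⟨g, rfl⟩
  have hre : r e ∈ s := by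
    have := hs (γ e)⁻¹ e he
    rwa [← eq_inv_smul_iff.2 (hγ e)] at this
  have key := hx (r e) hre ((g * γ e)⁻¹ * γ (g • e)) <| by
    rw [mul_smul, inv_smul_eq_iff, mul_smul, hγ e, ← hrg, hγ]
  rw [mul_smul, inv_smul_eq_iff, mul_smul] at key
  simp only [hrg, key]

/-- A finitely generated group acting on a connected graph leaves invariant a set of vertices
which is minimal among nonempty invariant sets spanning a connected subgraph. -/
theorem SimpleGraph.Connected.exists_minimal_invariant {G : Type*} {V : Type*} [Group G]
    [MulAction G V] (hG : Group.FG G) {Γ : SimpleGraph V} (hΓ : Γ.Connected)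
    (hadj : ∀ (g : G) a b, Γ.Adj a b → Γ.Adj (g • a) (g • b)) :
    ∃ S : Set V, S.Nonempty ∧ (∀ g : G, ∀ w ∈ S, g • w ∈ S) ∧ (Γ.induce S).Connected ∧
      ∀ S' ⊆ S, S'.Nonempty → (∀ g : G, ∀ w ∈ S', g • w ∈ S') →
        (Γ.induce S').Connected → S' = S := by
  classical
  let π : V → MulAction.orbitRel.Quotient G V := Quotient.mk _
  let P : Set V → Prop := fun S => S.Nonempty ∧ (∀ g : G, ∀ w ∈ S, g • w ∈ S) ∧
    (Γ.induce S).Connected ∧ (π '' S).Finite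
  have hP : ∃ S, P S := by
    obtain ⟨A, hA⟩ := Group.fg_def.1 hG
    obtain ⟨x₀⟩ := hΓ.nonempty
    have p : ∀ g : G, Γ.Walk x₀ (g • x₀) := fun g =>
      (hΓ.preconnected x₀ (g • x₀)).some
    let K : Set V := {x₀} ∪ ⋃ g ∈ A, {v | v ∈ (p g).support}
    let U : Set V := ⋃ g : G, (fun v => g • v) '' K
    have hKU : ∀ (g : G), ∀ k ∈ K, g • k ∈ U := fun g k hk => Set.mem_iUnion.2 ⟨g, k, hk, rfl⟩
    have hinv : ∀ g : G, ∀ w ∈ U, g • w ∈ U := by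
      intro g w hw
      obtain ⟨h, k, hk, rfl⟩ := Set.mem_iUnion.1 hw
      simpa [mul_smul] using hKU (g * h) k hk
    have hx₀ : x₀ ∈ K := .inl rfl
    have hx : ∀ g : G, g • x₀ ∈ U := fun g => hKU g x₀ hx₀
    have trans : ∀ (g : G) {a b : U}, (Γ.induce U).Reachable a b →
        (Γ.induce U).Reachable ⟨g • a, hinv g a a.2⟩ ⟨g • b, hinv g b b.2⟩ := fun g a b h =>
      h.map_of_adj_or_eq (fun a : U => (⟨g • (a : V), hinv g a a.2⟩ : U))
        fun a b h => .inr (hadj g a b h)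
    have hsupp : ∀ g ∈ A, ∀ v ∈ (p g).support, v ∈ U := fun g hg v hv => by
      simpa using hKU 1 v (.inr (Set.mem_iUnion₂.2 ⟨g, hg, hv⟩))
    have hx₀U : x₀ ∈ U := by simpa using hx 1
    have hwalk : ∀ g (hg : g ∈ A) v (hv : v ∈ (p g).support),
        (Γ.induce U).Reachable ⟨x₀, hx₀U⟩ ⟨v, hsupp g hg v hv⟩ := fun g hg v hv =>
      ⟨((p g).takeUntil v hv).induce U fun w hw =>
        hsupp g hg w ((p g).support_takeUntil_subset_support hv hw)⟩
    have horb : ∀ g : G, (Γ.induce U).Reachable ⟨x₀, hx₀U⟩ ⟨g • x₀, hx g⟩ := by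
      intro g
      have hg : g ∈ Subgroup.closure (A : Set G) := hA ▸ Subgroup.mem_top g
      induction hg using Subgroup.closure_induction with
      | mem g hg => exact hwalk g hg _ (p g).end_mem_support
      | one => simp
      | mul g h _ _ ihg ihh =>
        have := ihg.trans (trans g ihh)
        simpa [mul_smul] using this
      | inv g _ ih =>
        have := (trans g⁻¹ ih).symm
        simpa using this
    have hreach : ∀ u : U, (Γ.induce U).Reachable ⟨x₀, hx₀U⟩ u := by
      rintro ⟨u, hu⟩
      obtain ⟨g, k, hk, rfl⟩ := Set.mem_iUnion.1 hu
      refine (horb g).trans ?_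
      rcases hk with rfl | hk
      · rfl
      · obtain ⟨a, ha, hk⟩ := Set.mem_iUnion₂.1 hk
        exact trans g (hwalk a ha k hk)
    have hKfin : K.Finite := (Set.finite_singleton _).union <|
      A.finite_toSet.biUnion fun g _ => List.finite_toSet _
    have : Nonempty U := ⟨⟨x₀, hx₀U⟩⟩
    refine ⟨U, ⟨x₀, hx₀U⟩, hinv, ⟨fun a b => (hreach a).symm.trans (hreach b)⟩,
      (hKfin.image π).subset ?_⟩
    rintro _ ⟨u, hu, rfl⟩
    obtain ⟨g, k, hk, rfl⟩ := Set.mem_iUnion.1 hu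
    exact ⟨k, hk, Quotient.sound (MulAction.orbitRel_apply.2 ⟨g⁻¹, by simp⟩)⟩
  obtain ⟨S, ⟨hne, hinv, hconn, hfin⟩, hmin⟩ :=
    WellFounded.has_min (InvImage.wf (fun S => (π '' S).ncard) Nat.lt_wfRel.wf) {S | P S} hP
  refine ⟨S, hne, hinv, hconn, fun S' hS' hne' hinv' hconn' => hS'.antisymm fun x hx => ?_⟩
  have hsub : π '' S' ⊆ π '' S := Set.image_mono hS'
  have heq : π '' S' = π '' S := Set.eq_of_subset_of_ncard_le hsub
    (not_lt.1 (hmin S' ⟨hne', hinv', hconn', hfin.subset hsub⟩)) hfin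
  obtain ⟨y, hy, hxy⟩ := heq ▸ Set.mem_image_of_mem π hx
  obtain ⟨g, rfl⟩ := MulAction.orbitRel_apply.1 (Quotient.exact hxy.symm)
  exact hinv' g y hy

namespace GTree

variable {G : Type u} [Group G]

instance (T : GTree G) : MulAction G T.V where
  smul := T.act
  one_smul := T.act_one
  mul_smul := T.act_mul

/-- The subtree of a tree with a `G`-action spanned by an invariant set of vertices which is
minimal among invariant sets spanning a connected subgraph. -/
def ofMinimalInvariant {V : Type u} [MulAction G V] (Γ : SimpleGraph V) (hΓ : Γ.IsAcyclic)
    (hadj : ∀ (g : G) a b, Γ.Adj a b → Γ.Adj (g • a) (g • b))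
    (hinvers : ∀ (g : G) a b, Γ.Adj a b → ¬(g • a = b ∧ g • b = a)) (S : Set V)
    (hne : S.Nonempty) (hinv : ∀ g : G, ∀ w ∈ S, g • w ∈ S) (hconn : (Γ.induce S).Connected)
    (hmin : ∀ S' ⊆ S, S'.Nonempty → (∀ g : G, ∀ w ∈ S', g • w ∈ S') →
      (Γ.induce S').Connected → S' = S) : GTree G where
  V := S
  graph := Γ.induce S
  nonempty := hne.to_subtype
  connected := hconn
  acyclic := hΓ.induce S
  act g w := ⟨g • (w : V), hinv g w w.2⟩
  act_one w := Subtype.ext (one_smul G (w : V))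
  act_mul g h w := Subtype.ext (mul_smul g h (w : V))
  act_adj g a b h := hadj g a b h
  noInversion g a b h := fun h' =>
    hinvers g a b h ⟨congrArg Subtype.val h'.1, congrArg Subtype.val h'.2⟩
  minimal S' hne' hinv' hconn' := by
    have himg : Subtype.val '' S' = S := by
      refine hmin _ (Subtype.coe_image_subset S S') (hne'.image _) ?_
        (hconn'.induce_image Subtype.val fun a b h => .inr h)
      rintro g _ ⟨w, hw, rfl⟩
      exact ⟨_, hinv' g w hw, rfl⟩
    refine Set.eq_univ_of_forall fun x => ?_
    obtain ⟨y, hy, hyx⟩ : (x : V) ∈ Subtype.val '' S' := himg.symm ▸ x.2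
    rwa [← Subtype.ext hyx]

/-- If the edge stabilizers of `T` are elliptic in `T₀`, then `T` has a refinement `S` dominating
`T₀`, each edge stabilizer of which fixes an edge of `T` or of `T₀`. -/
theorem exists_refinement_dominating (hG : Group.FG G) (T T₀ : GTree G)
    (hell : ∀ a b, T.graph.Adj a b → T₀.EllipticSubgroup (T.edgeStab a b)) :
    ∃ (S : GTree G) (f : S.V → T.V), IsCollapseMap S T f ∧ S.Dominates T₀ ∧
      ∀ a b, S.graph.Adj a b →
        (∃ x y, T.graph.Adj x y ∧ S.edgeStab a b ≤ T.edgeStab x y) ∨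
        ∃ x y, T₀.graph.Adj x y ∧ S.edgeStab a b ≤ T₀.edgeStab x y := by
  let _ : MulAction G (Sym2 T.V) :=
    { smul := fun g e => e.map (g • ·)
      one_smul := fun e => by
        induction e with
        | _ a b => exact congrArg₂ (fun a b => s(a, b)) (one_smul G a) (one_smul G b)
      mul_smul := fun g h e => by
        induction e with
        | _ a b => exact congrArg₂ (fun a b => s(a, b)) (mul_smul g h a) (mul_smul g h b) }
  have smul_mk : ∀ (g : G) (a b : T.V), g • s(a, b) = s(g • a, g • b) := fun _ _ _ => rfl
  have := T₀.nonempty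
  obtain ⟨q, hq⟩ := MulAction.exists_equivariant_of_fixed (G := G) (X := T₀.V) T.graph.edgeSet
    (by
      intro g e he
      induction e with
      | _ a b => exact T.act_adj g a b he)
    (by
      intro e he
      induction e with
      | _ a b =>
        obtain ⟨x, hx⟩ := hell a b he
        refine ⟨x, fun g hg => hx g ?_⟩
        rw [smul_mk, Sym2.eq_iff] at hg
        rcases hg with hg | hg
        · exact hg
        · exact absurd hg (T.noInversion g a b he))
  replace hq : ∀ (g : G) a b, T.graph.Adj a b → q s(g • a, g • b) = g • q s(a, b) :=
    fun g a b h => hq g s(a, b) h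
  let Γ := T.graph.blowup T₀.graph q
  have hconn : Γ.Connected := SimpleGraph.blowup_connected T.connected T₀.connected
  have hacyc : Γ.IsAcyclic := SimpleGraph.blowup_isAcyclic ⟨T.connected, T.acyclic⟩ T₀.acyclic
  have hadj : ∀ (g : G) a b, Γ.Adj a b → Γ.Adj (g • a) (g • b) := by
    rintro g ⟨v, x⟩ ⟨w, y⟩ (⟨h, h'⟩ | ⟨h, h₁, h₂⟩)
    · exact .inl ⟨congrArg (g • ·) h, T₀.act_adj g _ _ h'⟩
    · exact .inr ⟨T.act_adj g _ _ h, (congrArg (g • ·) h₁).trans (hq g v w h).symm,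
        (congrArg (g • ·) h₂).trans (hq g v w h).symm⟩
  have hinvers : ∀ (g : G) a b, Γ.Adj a b → ¬(g • a = b ∧ g • b = a) := by
    rintro g ⟨v, x⟩ ⟨w, y⟩ h ⟨h₁, h₂⟩
    simp only [Prod.smul_mk, Prod.mk.injEq] at h₁ h₂
    rcases h with ⟨-, h⟩ | ⟨h, -⟩
    · exact T₀.noInversion g x y h ⟨h₁.2, h₂.2⟩
    · exact T.noInversion g v w h ⟨h₁.1, h₂.1⟩
  obtain ⟨S, hne, hinv, hSconn, hmin⟩ := hconn.exists_minimal_invariant hG hadj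
  have hsurj : Prod.fst '' S = Set.univ := by
    refine T.minimal _ (hne.image _) ?_
      (hSconn.induce_image Prod.fst SimpleGraph.blowup_fst_adj_or_eq)
    rintro g _ ⟨w, hw, rfl⟩
    exact ⟨g • w, hinv g w hw, rfl⟩
  let Ŝ := ofMinimalInvariant Γ hacyc hadj hinvers S hne hinv hSconn hmin
  have fst_fixed : ∀ (g : G) (a : S), Ŝ.act g a = a → T.act g a.1.1 = a.1.1 := fun g a h =>
    congrArg (fun x : S => x.1.1) h
  have snd_fixed : ∀ (g : G) (a : S), Ŝ.act g a = a → T₀.act g a.1.2 = a.1.2 := fun g a h =>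
    congrArg (fun x : S => x.1.2) h
  refine ⟨Ŝ, fun a : S => a.1.1, ⟨fun g w => rfl, fun v => ?_, ?_, fun v => ?_⟩, ?_, ?_⟩
  · obtain ⟨w, hw, rfl⟩ := hsurj ▸ Set.mem_univ v
    exact ⟨⟨w, hw⟩, rfl⟩
  · exact fun a b h => SimpleGraph.blowup_fst_adj_or_eq a.1 b.1 h
  · obtain ⟨w, hw, hwv⟩ := hsurj ▸ Set.mem_univ v
    have hpre := hacyc.preconnected_induce_inter hSconn.preconnected
      (SimpleGraph.blowup_induce_fiber_preconnected T₀.connected v)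
    have : Nonempty ((fun a : S => a.1.1) ⁻¹' {v}) := ⟨⟨⟨w, hw⟩, hwv⟩⟩
    refine @SimpleGraph.Connected.mk _ _ ?_ this
    rintro ⟨⟨a, ha⟩, hav⟩ ⟨⟨b, hb⟩, hbv⟩
    exact (hpre ⟨a, ha, hav⟩ ⟨b, hb, hbv⟩).map_of_adj_or_eq
      (Δ := Ŝ.graph.induce ((fun a : S => a.1.1) ⁻¹' {v}))
      (fun c => ⟨⟨c.1, c.2.1⟩, c.2.2⟩) fun _ _ h => .inr h
  · rintro H ⟨a, ha⟩
    exact ⟨a.1.2, fun h hh => snd_fixed h a (ha h hh)⟩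
  · rintro a b (⟨-, h⟩ | ⟨h, -⟩)
    · exact .inr ⟨_, _, h, fun g hg => ⟨snd_fixed g a hg.1, snd_fixed g b hg.2⟩⟩
    · exact .inl ⟨_, _, h, fun g hg => ⟨fst_fixed g a hg.1, fst_fixed g b hg.2⟩⟩

end GTree

theorem GTree.UnivEllipticSubgroup.mono {G : Type u} [Group G] {𝒜 : Set (Subgroup G)}
    {H K : Subgroup G} (hH : UnivEllipticSubgroup 𝒜 H) (hKH : K ≤ H) :
    UnivEllipticSubgroup 𝒜 K := fun T hT =>
  (hH T hT).imp fun _ hw k hk => hw k (hKH hk)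

/-- any universally elliptic `𝒜`-tree may be refined to a JSJ tree,
provided a JSJ tree exists. -/
theorem refine_to_jsj {G : Type u} [Group G] (hfg : Group.FG G)
    (𝒜 : Set (Subgroup G)) (h𝒜 : ClosedFamily 𝒜)
    (hex : ∃ T₀ : GTree G, T₀.IsJSJ 𝒜)
    (T : GTree G) (hT : T.IsATree 𝒜) (hTue : T.UnivEllipticTree 𝒜) :
    ∃ (S : GTree G) (f : S.V → T.V), S.IsJSJ 𝒜 ∧ GTree.IsCollapseMap S T f := by
  obtain ⟨T₀, hT₀A, hT₀ue, hT₀dom⟩ := hex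
  obtain ⟨S, f, hf, hdom, hedge⟩ :=
    GTree.exists_refinement_dominating hfg T T₀ fun a b h => hTue a b h T₀ hT₀A
  refine ⟨S, f, ⟨fun a b h => ?_, fun a b h => ?_, fun T' hT'A hT'ue H hH =>
    hT₀dom T' hT'A hT'ue H (hdom H hH)⟩, hf⟩
  · rcases hedge a b h with ⟨x, y, hxy, hle⟩ | ⟨x, y, hxy, hle⟩
    · exact h𝒜.2 _ (hT x y hxy) _ hle
    · exact h𝒜.2 _ (hT₀A x y hxy) _ hle
  · rcases hedge a b h with ⟨x, y, hxy, hle⟩ | ⟨x, y, hxy, hle⟩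
    · exact (hTue x y hxy).mono hle
    · exact (hT₀ue x y hxy).mono hle
end

section
/- Let T be a universally elliptic 𝒜-tree, let v be a vertex of T with stabilizer G_v. A subgroup H ≤ G_v is universally elliptic (i.e., elliptic in every 𝒜-tree of G) if and only if H is elliptic in every G_v-tree whose edge stabilizers belong to 𝒜 and in which every incident edge stabilizer at v is elliptic. -/
universe u v

namespace SimpleGraph

variable {X X' : Type*} {Γ : SimpleGraph X} {Γ' : SimpleGraph X'}

/-- `b` can be reached from `a` by a walk of `Γ` that stays in `F`. -/
def ReachableIn (Γ : SimpleGraph X) (F : Set X) (a b : X) : Prop :=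
  ∃ p : Γ.Walk a b, ∀ z ∈ p.support, z ∈ F

/-- Any two vertices of `F` are joined by a walk of `Γ` that stays in `F`. -/
def ConnectedOn (Γ : SimpleGraph X) (F : Set X) : Prop :=
  ∀ a ∈ F, ∀ b ∈ F, Γ.ReachableIn F a b

namespace ReachableIn

variable {F : Set X} {a b c : X}

theorem refl (ha : a ∈ F) : Γ.ReachableIn F a a :=
  ⟨.nil, by simpa using ha⟩

theorem symm (h : Γ.ReachableIn F a b) : Γ.ReachableIn F b a := by
  obtain ⟨p, hp⟩ := h
  exact ⟨p.reverse, by simpa using hp⟩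

theorem trans (h : Γ.ReachableIn F a b) (h' : Γ.ReachableIn F b c) : Γ.ReachableIn F a c := by
  obtain ⟨p, hp⟩ := h
  obtain ⟨q, hq⟩ := h'
  refine ⟨p.append q, fun z hz ↦ ?_⟩
  rcases (Walk.mem_support_append_iff _ _).1 hz with h | h
  exacts [hp z h, hq z h]

theorem of_adj (h : Γ.Adj a b) (ha : a ∈ F) (hb : b ∈ F) : Γ.ReachableIn F a b :=
  ⟨.cons h .nil, by simp [ha, hb]⟩

theorem map {F' : Set X'} (f : X → X') (hF : ∀ x ∈ F, f x ∈ F')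
    (hf : ∀ x ∈ F, ∀ y ∈ F, Γ.Adj x y → f x = f y ∨ Γ'.Adj (f x) (f y))
    (h : Γ.ReachableIn F a b) : Γ'.ReachableIn F' (f a) (f b) := by
  obtain ⟨p, hp⟩ := h
  induction p with
  | nil => exact refl (hF _ (hp _ (by simp)))
  | @cons u v w huv q ih =>
    have hu : u ∈ F := hp _ (by simp)
    have hq : ∀ z ∈ q.support, z ∈ F := fun z hz ↦ hp z (by simp [hz])
    have hv : v ∈ F := hq _ (by simp)
    rcases hf u hu v hv huv with h | h
    · rw [h]
      exact ih hq
    · exact (of_adj h (hF u hu) (hF v hv)).trans (ih hq)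

end ReachableIn

theorem Reachable.map_of_eq_or_adj {a b : X} (f : X → X')
    (hf : ∀ x y, Γ.Adj x y → f x = f y ∨ Γ'.Adj (f x) (f y))
    (h : Γ.Reachable a b) : Γ'.Reachable (f a) (f b) := by
  obtain ⟨p⟩ := h
  induction p with
  | nil => exact .refl _
  | cons huv q ih =>
    rcases hf _ _ huv with h | h
    · rwa [h]
    · exact h.reachable.trans ih

theorem induce_connected_iff_connectedOn {F : Set X} :
    (Γ.induce F).Connected ↔ F.Nonempty ∧ Γ.ConnectedOn F := by
  constructor
  · intro h
    refine ⟨Set.nonempty_coe_sort.1 h.nonempty, fun a ha b hb ↦ ?_⟩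
    obtain ⟨p⟩ := h ⟨a, ha⟩ ⟨b, hb⟩
    have hp : (Γ.induce F).ReachableIn Set.univ ⟨a, ha⟩ ⟨b, hb⟩ := ⟨p, fun _ _ ↦ trivial⟩
    exact hp.map Subtype.val (fun x _ ↦ x.2) fun x _ y _ hxy ↦ Or.inr hxy
  · rintro ⟨hne, h⟩
    have := hne.to_subtype
    refine ⟨fun a b ↦ ?_⟩
    obtain ⟨p, hp⟩ := h a a.2 b b.2
    exact ⟨p.induce F hp⟩

theorem IsAcyclic.eq_of_isPath (hΓ : Γ.IsAcyclic) {a b : X} {p q : Γ.Walk a b} (hp : p.IsPath)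
    (hq : q.IsPath) : p = q :=
  congrArg Subtype.val ((hΓ.subsingleton_path a b).elim ⟨p, hp⟩ ⟨q, hq⟩)

theorem IsAcyclic.support_subset {F : Set X} (hΓ : Γ.IsAcyclic) {a b : X}
    (h : Γ.ReachableIn F a b) {q : Γ.Walk a b} (hq : q.IsPath) : ∀ z ∈ q.support, z ∈ F := by
  classical
  obtain ⟨p, hp⟩ := h
  have : q = p.bypass := hΓ.eq_of_isPath hq p.bypass_isPath
  subst this
  exact fun z hz ↦ hp z (p.support_bypass_subset_support hz)

theorem ConnectedOn.inter {F F' : Set X} (hΓ : Γ.IsAcyclic) (hF : Γ.ConnectedOn F)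
    (hF' : Γ.ConnectedOn F') : Γ.ConnectedOn (F ∩ F') := by
  intro a ha b hb
  obtain ⟨p, -⟩ := hF a ha.1 b hb.1
  obtain ⟨q, hq⟩ := p.reachable.exists_isPath
  exact ⟨q, fun z hz ↦ ⟨hΓ.support_subset (hF a ha.1 b hb.1) hq z hz,
    hΓ.support_subset (hF' a ha.2 b hb.2) hq z hz⟩⟩

/-- The endpoint of a path to a subtree `N` meeting `N` only at its endpoint is determined by the
starting point. -/
theorem IsAcyclic.eq_of_isPath_of_forall_mem {N : Set X} (hΓ : Γ.IsAcyclic) (hN : Γ.ConnectedOn N)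
    {z a b : X} (p : Γ.Walk z a) (q : Γ.Walk z b) (hp : p.IsPath) (hq : q.IsPath) (ha : a ∈ N)
    (hb : b ∈ N) (hpN : ∀ x ∈ p.support, x ∈ N → x = a)
    (hqN : ∀ x ∈ q.support, x ∈ N → x = b) : a = b := by
  obtain ⟨w₀, -⟩ := hN a ha b hb
  obtain ⟨w, hw⟩ := w₀.reachable.exists_isPath
  have hwN := hΓ.support_subset (hN a ha b hb) hw
  have hpw : (p.append w).IsPath := by
    have hw' := hw.support_nodup
    rw [← Walk.cons_tail_support, List.nodup_cons] at hw'
    rw [Walk.isPath_def, Walk.support_append]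
    refine hp.support_nodup.append hw'.2 fun x hx hx' ↦ ?_
    have := hpN x hx (hwN x (List.mem_of_mem_tail hx'))
    subst this
    exact hw'.1 hx'
  have : q = p.append w := hΓ.eq_of_isPath hq hpw
  subst this
  exact hqN a ((Walk.mem_support_append_iff _ _).2 (Or.inl (by simp))) ha

/-- Every vertex `z` has a projection to a subtree `N`, fixed by every injective endomorphism which
fixes `z` and preserves `N` and its complement. -/
theorem IsAcyclic.exists_projection {N : Set X} (hΓ : Γ.IsAcyclic) (hN : Γ.ConnectedOn N)
    {z n : X} (hn : n ∈ N) (hz : Γ.Reachable z n) :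
    ∃ a ∈ N, ∀ φ : Γ →g Γ, Function.Injective φ → (∀ x, φ x ∈ N ↔ x ∈ N) → φ z = z → φ a = a := by
  classical
  have hex : ∃ k, ∃ a ∈ N, ∃ p : Γ.Walk z a, p.IsPath ∧ p.length = k := by
    obtain ⟨p, hp⟩ := hz.exists_isPath
    exact ⟨_, n, hn, p, hp, rfl⟩
  obtain ⟨a, ha, p, hp, hpk⟩ := Nat.find_spec hex
  have hpN : ∀ x ∈ p.support, x ∈ N → x = a := by
    intro x hx hxN
    by_contra hxa
    refine Nat.find_min hex (m := (p.takeUntil x hx).length) ?_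
      ⟨x, hxN, _, hp.takeUntil hx, rfl⟩
    rw [← hpk]
    exact Walk.length_takeUntil_lt_length hx hxa
  refine ⟨a, ha, fun φ hφ hφN hφz ↦ ?_⟩
  refine hΓ.eq_of_isPath_of_forall_mem hN ((p.map φ).copy hφz rfl) p ?_ hp
    ((hφN a).2 ha) ha ?_ hpN
  · simpa using hp.map hφ
  · intro x hx hxN
    simp only [Walk.support_copy, Walk.support_map, List.mem_map] at hx
    obtain ⟨y, hy, rfl⟩ := hx
    rw [hpN y hy ((hφN y).1 hxN)]

/-- In a tree there is a consistent choice, for `b ≠ a`, of the neighbour of `a` on the path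
from `a` to `b`. -/
theorem IsTree.exists_neighbor_toward (hΓ : Γ.IsTree) (a : X) :
    ∃ next : X → X, (∀ b, Γ.Adj a b → next b = b) ∧
      ∀ b c, Γ.Adj b c → b ≠ a → c ≠ a → next b = next c := by
  choose p hp using fun b ↦ (hΓ.connected a b).exists_isPath
  have key : ∀ b c (h : Γ.Adj b c), b ≠ a → p c = (p b).concat h → (p b).snd = (p c).snd := by
    intro b c h hb hpc
    rw [hpc, Walk.concat_eq_append]
    cases hpb : p b with
    | nil => exact absurd rfl hb
    | cons h' q => simp [Walk.cons_append]
  refine ⟨fun b ↦ (p b).snd, fun b hab ↦ ?_, fun b c hbc hb hc ↦ ?_⟩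
  · have hpath : (Walk.cons hab .nil : Γ.Walk a b).IsPath := by simp [hab.ne]
    have : p b = .cons hab .nil := hΓ.isAcyclic.eq_of_isPath (hp b) hpath
    simp [this]
  · by_cases hmem : b ∈ (p c).support
    · exact key b c hbc hb (hΓ.isAcyclic.path_concat (hp b) (hp c) hbc hmem)
    · exact (key c b hbc.symm hc (hΓ.isAcyclic.path_concat (hp c) (hp b) hbc.symm
        (hΓ.isAcyclic.mem_support_of_ne_mem_support_of_adj_of_isPath (hp b) (hp c) hbc hmem))).symm

end SimpleGraph

/-- An action without inversions of `G` on the tree `Γ` by graph automorphisms. -/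
structure IsTreeAction (G : Type*) [Group G] {X : Type*} [MulAction G X] (Γ : SimpleGraph X) :
    Prop where
  isTree : Γ.IsTree
  adj_smul : ∀ (g : G) (a b : X), Γ.Adj a b → Γ.Adj (g • a) (g • b)
  noInversion : ∀ (g : G) (a b : X), Γ.Adj a b → ¬(g • a = b ∧ g • b = a)

namespace IsTreeAction

open SimpleGraph

variable {G X : Type*} [Group G] [MulAction G X] {Γ : SimpleGraph X}

theorem reachableIn_smul (hΓ : IsTreeAction G Γ) {F : Set X} (hF : ∀ g : G, ∀ x ∈ F, g • x ∈ F)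
    (g : G) {a b : X} (h : Γ.ReachableIn F a b) : Γ.ReachableIn F (g • a) (g • b) :=
  h.map (g • ·) (hF g) fun x _ y _ hxy ↦ Or.inr (hΓ.adj_smul g x y hxy)

/-- If a group fixes a vertex and preserves a subtree, then it fixes a vertex of this subtree. -/
theorem exists_fixed_mem (hΓ : IsTreeAction G Γ) (H : Subgroup G) {N : Set X} (hne : N.Nonempty)
    (hN : Γ.ConnectedOn N) (hinv : ∀ h ∈ H, ∀ x ∈ N, h • x ∈ N) {z : X}
    (hz : ∀ h ∈ H, h • z = z) : ∃ a ∈ N, ∀ h ∈ H, h • a = a := by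
  obtain ⟨n, hn⟩ := hne
  obtain ⟨a, ha, hfix⟩ := hΓ.isTree.isAcyclic.exists_projection hN hn (hΓ.isTree.connected z n)
  refine ⟨a, ha, fun h hh ↦ ?_⟩
  refine hfix ⟨(h • ·), fun {x y} ↦ hΓ.adj_smul h x y⟩ (MulAction.injective h)
    (fun x ↦ ⟨fun hx ↦ ?_, hinv h hh x⟩) (hz h hh)
  have := hinv h⁻¹ (inv_mem hh) _ hx
  simpa using this

/-- A finitely generated group acting on a tree has an invariant subtree with finitely many
orbits. -/
theorem exists_subtree_finite_orbits (hΓ : IsTreeAction G Γ) (hfg : Group.FG G) (x : X) :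
    ∃ F D : Set X, F.Nonempty ∧ (∀ g : G, ∀ x ∈ F, g • x ∈ F) ∧ Γ.ConnectedOn F ∧ D.Finite ∧
      ∀ x ∈ F, ∃ g : G, ∃ d ∈ D, x = g • d := by
  obtain ⟨S, hS, hSfin⟩ := Group.fg_iff.1 hfg
  let p (g : G) : Γ.Walk x (g • x) := (hΓ.isTree.connected x (g • x)).some
  let D : Set X := {x} ∪ ⋃ s ∈ S, {y | y ∈ (p s).support}
  let F : Set X := {y | ∃ g : G, ∃ d ∈ D, y = g • d}
  have hDF : D ⊆ F := fun d hd ↦ ⟨1, d, hd, by simp⟩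
  have hxF : x ∈ F := hDF (Or.inl rfl)
  have hF : ∀ g : G, ∀ x ∈ F, g • x ∈ F := by
    rintro g _ ⟨g', d, hd, rfl⟩
    exact ⟨g * g', d, hd, by rw [mul_smul]⟩
  have hsD : ∀ s ∈ S, ∀ z ∈ (p s).support, z ∈ F := fun s hs z hz ↦
    hDF (Or.inr (Set.mem_biUnion hs hz))
  have hx : ∀ g : G, Γ.ReachableIn F x (g • x) := by
    intro g
    have hg : g ∈ Subgroup.closure S := by simp [hS]
    induction hg using Subgroup.closure_induction with
    | mem s hs => exact ⟨p s, hsD s hs⟩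
    | one => simpa using ReachableIn.refl hxF
    | mul g g' _ _ hg hg' =>
      rw [mul_smul]
      exact hg.trans (hΓ.reachableIn_smul hF g hg')
    | inv g _ hg => simpa using (hΓ.reachableIn_smul hF g⁻¹ hg).symm
  have hd : ∀ d ∈ D, Γ.ReachableIn F x d := by
    classical
    rintro d (rfl | hd)
    · exact .refl hxF
    · obtain ⟨s, hs, hd⟩ := Set.mem_iUnion₂.1 hd
      exact ⟨(p s).takeUntil d hd, fun z hz ↦
        hsD s hs z ((p s).support_takeUntil_subset_support hd hz)⟩
  have hy : ∀ y ∈ F, Γ.ReachableIn F x y := by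
    rintro _ ⟨g, d, hdD, rfl⟩
    exact (hx g).trans (hΓ.reachableIn_smul hF g (hd d hdD))
  refine ⟨F, D, ⟨x, hxF⟩, hF, fun a ha b hb ↦ (hy a ha).symm.trans (hy b hb), ?_, fun x hx ↦ hx⟩
  exact (Set.finite_singleton x).union (hSfin.biUnion fun s _ ↦ (p s).support.finite_toSet)

/-- An invariant subtree with finitely many orbits contains a minimal invariant subtree. -/
theorem exists_minimal_subtree {F D : Set X} (hne : F.Nonempty)
    (hF : ∀ g : G, ∀ x ∈ F, g • x ∈ F) (hconn : Γ.ConnectedOn F) (hD : D.Finite)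
    (hFD : ∀ x ∈ F, ∃ g : G, ∃ d ∈ D, x = g • d) :
    ∃ M ⊆ F, M.Nonempty ∧ (∀ g : G, ∀ x ∈ M, g • x ∈ M) ∧ Γ.ConnectedOn M ∧
      ∀ N ⊆ M, N.Nonempty → (∀ g : G, ∀ x ∈ N, g • x ∈ N) → Γ.ConnectedOn N → N = M := by
  have hex : ∃ k, ∃ M ⊆ F, M.Nonempty ∧ (∀ g : G, ∀ x ∈ M, g • x ∈ M) ∧ Γ.ConnectedOn M ∧
      (M ∩ D).ncard = k := ⟨_, F, subset_rfl, hne, hF, hconn, rfl⟩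
  classical
  obtain ⟨M, hMF, hMne, hM, hMc, hMk⟩ := Nat.find_spec hex
  refine ⟨M, hMF, hMne, hM, hMc, fun N hNM hNne hN hNc ↦ hNM.antisymm fun x hx ↦ ?_⟩
  have hle : (M ∩ D).ncard ≤ (N ∩ D).ncard := by
    rw [hMk]
    exact Nat.find_min' hex ⟨N, hNM.trans hMF, hNne, hN, hNc, rfl⟩
  have heq : N ∩ D = M ∩ D := Set.eq_of_subset_of_ncard_le (Set.inter_subset_inter_left D hNM) hle
    (hD.subset Set.inter_subset_right)
  obtain ⟨g, d, hd, rfl⟩ := hFD x (hMF hx)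
  have hdM : d ∈ M ∩ D := ⟨by simpa using hM g⁻¹ _ hx, hd⟩
  rw [← heq] at hdM
  exact hN g d hdM.1

end IsTreeAction

namespace GTree

open SimpleGraph

variable {G : Type u} [Group G]

instance inst_s12 (T : GTree G) : MulAction G T.V where
  smul := T.act
  one_smul := T.act_one
  mul_smul := T.act_mul

theorem smul_def (T : GTree G) (g : G) (w : T.V) : g • w = T.act g w := rfl

theorem isTreeAction (T : GTree G) : IsTreeAction G T.graph :=
  ⟨⟨T.connected, T.acyclic⟩, T.act_adj, T.noInversion⟩

/-- A minimal invariant subtree, as a `G`-tree. -/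
def ofMinimalSubtree {X : Type u} [MulAction G X] {Γ : SimpleGraph X} (hΓ : IsTreeAction G Γ)
    {M : Set X} (hne : M.Nonempty) (hM : ∀ g : G, ∀ x ∈ M, g • x ∈ M) (hconn : Γ.ConnectedOn M)
    (hmin : ∀ N ⊆ M, N.Nonempty → (∀ g : G, ∀ x ∈ N, g • x ∈ N) → Γ.ConnectedOn N → N = M) :
    GTree G where
  V := M
  graph := Γ.induce M
  nonempty := hne.to_subtype
  connected := induce_connected_iff_connectedOn.2 ⟨hne, hconn⟩
  acyclic := hΓ.isTree.isAcyclic.induce M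
  act g x := ⟨g • x.1, hM g x x.2⟩
  act_one x := by simp
  act_mul g h x := by simp [mul_smul]
  act_adj g a b h := hΓ.adj_smul g a b h
  noInversion g a b h h' :=
    hΓ.noInversion g a b h ⟨congrArg Subtype.val h'.1, congrArg Subtype.val h'.2⟩
  minimal S hSne hS hSc := by
    obtain ⟨-, hSc⟩ := induce_connected_iff_connectedOn.1 hSc
    have := hmin (Subtype.val '' S) (by simp) (hSne.image _) ?_ ?_
    · refine Set.eq_univ_of_forall fun x ↦ ?_
      obtain ⟨y, hy, hyx⟩ : x.1 ∈ Subtype.val '' S := this.symm ▸ x.2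
      rwa [← Subtype.ext hyx]
    · rintro g _ ⟨x, hx, rfl⟩
      exact ⟨_, hS g x hx, rfl⟩
    · rintro _ ⟨x, hx, rfl⟩ _ ⟨y, hy, rfl⟩
      exact (hSc x hx y hy).map Subtype.val (fun z hz ↦ ⟨z, hz, rfl⟩) fun a _ b _ h ↦ Or.inr h

/-- An invariant subtree with finitely many orbits contains a copy of a `G`-tree. -/
theorem exists_embedding {X : Type u} [MulAction G X] {Γ : SimpleGraph X} (hΓ : IsTreeAction G Γ)
    {F D : Set X} (hne : F.Nonempty) (hF : ∀ g : G, ∀ x ∈ F, g • x ∈ F)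
    (hconn : Γ.ConnectedOn F) (hD : D.Finite) (hFD : ∀ x ∈ F, ∃ g : G, ∃ d ∈ D, x = g • d) :
    ∃ (S : GTree G) (j : S.V → X), Function.Injective j ∧ (∀ (g : G) x, j (g • x) = g • j x) ∧
      (∀ x y, S.graph.Adj x y → Γ.Adj (j x) (j y)) ∧ Γ.ConnectedOn (Set.range j) := by
  obtain ⟨M, -, hMne, hM, hMc, hmin⟩ :=
    IsTreeAction.exists_minimal_subtree hne hF hconn hD hFD
  refine ⟨ofMinimalSubtree hΓ hMne hM hMc hmin, Subtype.val, Subtype.val_injective,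
    fun g x ↦ rfl, fun x y h ↦ h, ?_⟩
  have : Set.range (Subtype.val : M → X) = M := Subtype.range_val
  exact this.symm ▸ hMc

end GTree

namespace SimpleGraph

variable {V Y : Type*}

/-- The graph obtained from `T` by replacing each vertex `a` by the subgraph of `Θ` spanned by
`P a`, an edge `{a, b}` of `T` being attached at `att a b` and `att b a`. -/
def blowup_s12 (T : SimpleGraph V) (Θ : SimpleGraph Y) (P : V → Set Y) (att : V → V → Y) :
    SimpleGraph {p : V × Y // p.2 ∈ P p.1} where
  Adj p q := (p.1.1 = q.1.1 ∧ Θ.Adj p.1.2 q.1.2) ∨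
    (T.Adj p.1.1 q.1.1 ∧ p.1.2 = att p.1.1 q.1.1 ∧ q.1.2 = att q.1.1 p.1.1)
  symm := ⟨fun _ _ h ↦ h.imp (fun h ↦ ⟨h.1.symm, h.2.symm⟩) fun h ↦ ⟨h.1.symm, h.2.2, h.2.1⟩⟩
  loopless := ⟨fun _ h ↦ h.elim (fun h ↦ h.2.ne rfl) fun h ↦ h.1.ne rfl⟩

variable {T : SimpleGraph V} {Θ : SimpleGraph Y} {P : V → Set Y} {att : V → V → Y}

theorem blowup_isAcyclic_s12 (hT : T.IsTree) (hΘ : Θ.IsAcyclic) :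
    (T.blowup_s12 Θ P att).IsAcyclic := by
  classical
  rw [isAcyclic_iff_forall_adj_isBridge]
  rintro ⟨⟨a, y⟩, hy⟩ ⟨⟨b, z⟩, hz⟩ hadj
  rw [isBridge_iff]
  intro hreach
  rcases hadj with ⟨hab, hyz⟩ | ⟨hab, hya, hzb⟩
  · obtain rfl : a = b := hab
    obtain ⟨next, hnext, hnext'⟩ := hT.exists_neighbor_toward a
    have hbridge := isAcyclic_iff_forall_adj_isBridge.1 hΘ hyz
    rw [isBridge_iff] at hbridge
    let r : {p : V × Y // p.2 ∈ P p.1} → Y :=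
      fun p ↦ if p.1.1 = a then p.1.2 else att a (next p.1.1)
    have := hreach.map_of_eq_or_adj (Γ' := Θ.deleteEdges {s(y, z)}) r ?_
    · exact hbridge (by simpa [r] using this)
    · rintro ⟨⟨c, s⟩, hs⟩ ⟨⟨d, t⟩, ht⟩ hcd
      rw [deleteEdges_adj] at hcd
      obtain ⟨⟨hcd, hst⟩ | ⟨hcd, hsc, htd⟩, hne⟩ := hcd
      · obtain rfl : c = d := hcd
        by_cases hc : c = a
        · subst hc
          right
          simp only [r, if_true, deleteEdges_adj]
          refine ⟨hst, fun h ↦ hne ?_⟩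
          simpa using h
        · simp [r, hc]
      · left
        replace hcd : T.Adj c d := hcd
        by_cases hc : c = a
        · subst hc
          simpa [r, hcd.ne', hnext d hcd] using hsc
        · by_cases hd : d = a
          · subst hd
            simpa [r, hc, hnext c hcd.symm] using htd.symm
          · simp [r, hc, hd, hnext' c d hcd hc hd]
  · have hbridge := isAcyclic_iff_forall_adj_isBridge.1 hT.isAcyclic hab
    rw [isBridge_iff] at hbridge
    refine hbridge (hreach.map_of_eq_or_adj (Γ' := T.deleteEdges {s(a, b)}) (fun p ↦ p.1.1) ?_)
    rintro ⟨⟨c, s⟩, hs⟩ ⟨⟨d, t⟩, ht⟩ hcd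
    rw [deleteEdges_adj] at hcd
    obtain ⟨⟨hcd, hst⟩ | ⟨hcd, hsc, htd⟩, hne⟩ := hcd
    · exact Or.inl hcd
    · right
      rw [deleteEdges_adj]
      refine ⟨hcd, fun h ↦ hne ?_⟩
      simp only at hya hzb hsc htd
      simp only [Set.mem_singleton_iff, Sym2.eq_iff] at h ⊢
      rcases h with ⟨rfl, rfl⟩ | ⟨rfl, rfl⟩
      · subst_vars
        exact Or.inl ⟨rfl, rfl⟩
      · subst_vars
        exact Or.inr ⟨rfl, rfl⟩

theorem blowup_connected_s12 (hT : T.Connected) (hP : ∀ a, (P a).Nonempty ∧ Θ.ConnectedOn (P a))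
    (hatt : ∀ a b, T.Adj a b → att a b ∈ P a) : (T.blowup_s12 Θ P att).Connected := by
  have hfib : ∀ a y z (hy : y ∈ P a) (hz : z ∈ P a),
      (T.blowup_s12 Θ P att).Reachable ⟨(a, y), hy⟩ ⟨(a, z), hz⟩ := by
    intro a y z hy hz
    obtain ⟨w, hw⟩ := (hP a).2 y hy z hz
    induction w with
    | nil => exact .refl _
    | @cons s t u hst q ih =>
      have ht : t ∈ P a := hw t (by simp)
      refine Reachable.trans (v := ⟨(a, t), ht⟩) (Adj.reachable (Or.inl ⟨rfl, hst⟩)) ?_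
      exact ih ht hz fun x hx ↦ hw x (by simp [hx])
  obtain ⟨a₀⟩ := hT.nonempty
  obtain ⟨y₀, hy₀⟩ := (hP a₀).1
  have : Nonempty {p : V × Y // p.2 ∈ P p.1} := ⟨⟨(a₀, y₀), hy₀⟩⟩
  refine ⟨?_⟩
  rintro ⟨⟨a, y⟩, hy⟩ ⟨⟨b, z⟩, hz⟩
  obtain ⟨w⟩ := hT a b
  induction w generalizing y with
  | nil => exact hfib _ _ _ _ _
  | @cons a c b hac q ih =>
    refine (hfib a y (att a c) hy (hatt a c hac)).trans ?_
    refine Reachable.trans (v := ⟨(c, att c a), hatt c a hac.symm⟩) ?_ (ih _ _ hz)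
    exact Adj.reachable (Or.inr ⟨hac, rfl, rfl⟩)

end SimpleGraph

theorem MulAction.exists_equivariant_map {K A Y : Type*} [Group K] [MulAction K A] [MulAction K Y]
    [Nonempty Y] (P : A → Prop) (hP : ∀ (k : K) a, P a → P (k • a))
    (h : ∀ a, P a → ∃ y : Y, ∀ k : K, k • a = a → k • y = y) :
    ∃ f : A → Y, ∀ (k : K) a, P a → f (k • a) = k • f a := by
  classical
  choose! y hy using h
  let rep (a : A) : A := (Quotient.mk (orbitRel K A) a).out
  have hrep : ∀ (k : K) a, rep (k • a) = rep a := fun k a ↦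
    congrArg Quotient.out (Quotient.sound (s := orbitRel K A) ⟨k, rfl⟩)
  have hex : ∀ a, ∃ t : K, t • rep a = a := fun a ↦ by
    obtain ⟨k, hk⟩ := Quotient.mk_out (s := orbitRel K A) a
    exact ⟨k⁻¹, by rw [inv_smul_eq_iff]; exact hk.symm⟩
  choose t ht using hex
  refine ⟨fun a ↦ t a • y (rep a), fun k a ha ↦ ?_⟩
  have hPr : P (rep a) := by
    have := hP (t a)⁻¹ a ha
    rwa [inv_smul_eq_iff.2 (ht a).symm] at this
  have hfix : ((t a)⁻¹ * k⁻¹ * t (k • a)) • rep a = rep a := by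
    rw [mul_smul, mul_smul, ← hrep k a, ht, inv_smul_smul, inv_smul_eq_iff, hrep, ht]
  have := hy _ hPr _ hfix
  rw [mul_smul, mul_smul, inv_smul_eq_iff, inv_smul_eq_iff] at this
  simpa [hrep] using this

/-- An action of `G` on a tree mapping to the tree `T` so that the fibre over the vertex `v` is a
copy of the tree `Θ` on which the stabilizer `K` of `v` acts, and every edge is either mapped to an
edge of `T` or is a translate of an edge of `Θ`. -/
structure VertexBlowup (G : Type u) [Group G] {V Y : Type u} [MulAction G V] (T : SimpleGraph V)
    (v : V) (K : Subgroup G) [MulAction K Y] (Θ : SimpleGraph Y) where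
  X : Type u
  [action : MulAction G X]
  graph : SimpleGraph X
  isTree : graph.IsTree
  adj_smul : ∀ (g : G) (a b : X), graph.Adj a b → graph.Adj (g • a) (g • b)
  proj : X → V
  proj_smul : ∀ (g : G) x, proj (g • x) = g • proj x
  incl : Y → X
  incl_injective : Function.Injective incl
  incl_smul : ∀ (k : K) y, incl (k • y) = (k : G) • incl y
  proj_eq_iff : ∀ x, proj x = v ↔ ∃ y, incl y = x
  adj_incl : ∀ y z, graph.Adj (incl y) (incl z) ↔ Θ.Adj y z
  adj_cases : ∀ a b, graph.Adj a b → T.Adj (proj a) (proj b) ∨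
    ∃ (g : G) (y z : Y), Θ.Adj y z ∧ a = g • incl y ∧ b = g • incl z

namespace VertexBlowup

open SimpleGraph MulAction

variable {G : Type u} [Group G] {V Y : Type u} [MulAction G V] {T : SimpleGraph V} {v : V}
  {K : Subgroup G} [MulAction K Y] {Θ : SimpleGraph Y}

attribute [instance] VertexBlowup.action

open Classical in
/-- An element of `G` moving `v` to `w`, if there is one. -/
noncomputable def transporter (G : Type u) [Group G] {V : Type u} [MulAction G V] (v w : V) : G :=
  if h : ∃ g : G, g • v = w then h.choose else 1

theorem transporter_smul {w : V} (hw : w ∈ orbit G v) : transporter G v w • v = w := by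
  have h : ∃ g : G, g • v = w := hw
  rw [transporter, dif_pos h]
  exact h.choose_spec

theorem cocycle_mem (hK : ∀ g : G, g ∈ K ↔ g • v = v) (g : G) {w : V} (hw : w ∈ orbit G v) :
    (transporter G v (g • w))⁻¹ * g * transporter G v w ∈ K := by
  rw [hK, mul_smul, mul_smul, transporter_smul hw, inv_smul_eq_iff,
    transporter_smul (mem_orbit_of_mem_orbit g hw)]

open Classical in
/-- The cocycle measuring the failure of `transporter` to be equivariant. -/
noncomputable def cocycle (hK : ∀ g : G, g ∈ K ↔ g • v = v) (g : G) (w : V) : K :=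
  if hw : w ∈ orbit G v then ⟨_, cocycle_mem hK g hw⟩ else 1

theorem coe_cocycle (hK : ∀ g : G, g ∈ K ↔ g • v = v) (g : G) {w : V} (hw : w ∈ orbit G v) :
    (cocycle hK g w : G) = (transporter G v (g • w))⁻¹ * g * transporter G v w := by
  rw [cocycle, dif_pos hw]

theorem cocycle_of_notMem (hK : ∀ g : G, g ∈ K ↔ g • v = v) (g : G) {w : V}
    (hw : w ∉ orbit G v) : cocycle hK g w = 1 := by
  rw [cocycle, dif_neg hw]

theorem cocycle_one (hK : ∀ g : G, g ∈ K ↔ g • v = v) (w : V) : cocycle hK 1 w = 1 := by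
  by_cases hw : w ∈ orbit G v
  · ext
    simp [coe_cocycle hK 1 hw]
  · exact cocycle_of_notMem hK 1 hw

theorem cocycle_mul (hK : ∀ g : G, g ∈ K ↔ g • v = v) (g h : G) (w : V) :
    cocycle hK (g * h) w = cocycle hK g (h • w) * cocycle hK h w := by
  by_cases hw : w ∈ orbit G v
  · ext
    simp [coe_cocycle hK _ hw, coe_cocycle hK _ (mem_orbit_of_mem_orbit h hw), mul_smul, mul_assoc]
  · have hw' : h • w ∉ orbit G v := fun h' ↦ hw ((by simpa using mem_orbit_of_mem_orbit h⁻¹ h'))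
    simp [cocycle_of_notMem hK _ hw, cocycle_of_notMem hK _ hw']

/-- The `G`-set of pairs `(w, y)`, where `y` is arbitrary if `w` is in the orbit of `v` and
is the base point otherwise. -/
noncomputable abbrev pairAction (hK : ∀ g : G, g ∈ K ↔ g • v = v) (y₀ : Y) :
    MulAction G {p : V × Y // p.2 ∈ {y : Y | p.1 ∈ orbit G v ∨ y = y₀}} where
  smul g p := ⟨(g • p.1.1, cocycle hK g p.1.1 • p.1.2), by
    by_cases hw : p.1.1 ∈ orbit G v
    · exact Or.inl (mem_orbit_of_mem_orbit g hw)
    · exact Or.inr (by simpa [cocycle_of_notMem hK g hw] using p.2.resolve_left hw)⟩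
  one_smul p := Subtype.ext (Prod.ext (one_smul G _) (by
    change cocycle hK 1 p.1.1 • p.1.2 = p.1.2
    rw [cocycle_one, one_smul]))
  mul_smul g h p := Subtype.ext (Prod.ext (mul_smul g h _) (by
    change cocycle hK (g * h) p.1.1 • p.1.2 =
      cocycle hK g (h • p.1.1) • cocycle hK h p.1.1 • p.1.2
    rw [cocycle_mul, mul_smul]))

/-- A vertex of a tree can be blown up to a tree on which its stabilizer acts and in which
the incident edge stabilizers are elliptic. -/
theorem nonempty (hT : IsTreeAction G T) (hK : ∀ g : G, g ∈ K ↔ g • v = v)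
    (hΘ : IsTreeAction K Θ)
    (hell : ∀ w, T.Adj v w → ∃ y : Y, ∀ k : K, (k : G) • w = w → k • y = y) :
    Nonempty (VertexBlowup G T v K Θ) := by
  classical
  have hYne : Nonempty Y := hΘ.isTree.connected.nonempty
  obtain ⟨y₀⟩ := id hYne
  obtain ⟨f, hf⟩ := exists_equivariant_map (K := K) (T.Adj v)
    (fun k w hw ↦ by simpa only [(hK k).1 k.2] using! hT.adj_smul (k : G) v w hw) hell
  let att (a b : V) : Y := if a ∈ orbit G v then f ((transporter G v a)⁻¹ • b) else y₀
  have hadj : ∀ {a b}, a ∈ orbit G v → T.Adj a b → T.Adj v ((transporter G v a)⁻¹ • b) := by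
    intro a b ha hab
    have := hT.adj_smul (transporter G v a)⁻¹ a b hab
    rwa [inv_smul_eq_iff.2 (transporter_smul ha).symm] at this
  have hatt : ∀ (g : G) a b, T.Adj a b →
      att (g • a) (g • b) = cocycle hK g a • att a b := by
    intro g a b hab
    by_cases ha : a ∈ orbit G v
    · simp only [att, ha, mem_orbit_of_mem_orbit g ha, if_true]
      rw [← hf _ _ (hadj ha hab)]
      congr 1
      rw [Subgroup.smul_def, coe_cocycle hK g ha, smul_smul, smul_smul]
      simp
    · have ha' : g • a ∉ orbit G v := fun h' ↦ ha ((by simpa using mem_orbit_of_mem_orbit g⁻¹ h'))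
      simp [att, ha, ha', cocycle_of_notMem hK g ha]
  let P (a : V) : Set Y := {y | a ∈ orbit G v ∨ y = y₀}
  have hv : v ∈ orbit G v := mem_orbit_self v
  let := pairAction hK y₀
  refine ⟨{
    X := {p : V × Y // p.2 ∈ P p.1}
    action := pairAction hK y₀
    graph := T.blowup_s12 Θ P att
    isTree := ⟨blowup_connected_s12 hT.isTree.connected (fun a ↦ ⟨⟨y₀, Or.inr rfl⟩, ?_⟩) ?_,
      blowup_isAcyclic_s12 hT.isTree hΘ.isTree.isAcyclic⟩
    adj_smul := ?_
    proj := fun p ↦ p.1.1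
    proj_smul := fun _ _ ↦ rfl
    incl := fun y ↦ ⟨(v, (⟨_, (hK _).2 (transporter_smul hv)⟩ : K)⁻¹ • y), Or.inl hv⟩
    incl_injective := ?_
    incl_smul := ?_
    proj_eq_iff := ?_
    adj_incl := ?_
    adj_cases := ?_ }⟩
  · intro y hy z hz
    by_cases ha : a ∈ orbit G v
    · obtain ⟨p⟩ := hΘ.isTree.connected y z
      exact ⟨p, fun x _ ↦ Or.inl ha⟩
    · obtain rfl := hy.resolve_left ha
      obtain rfl := hz.resolve_left ha
      exact .refl hy
  · intro a b _
    by_cases ha : a ∈ orbit G v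
    · exact Or.inl ha
    · exact Or.inr (if_neg ha)
  · rintro g ⟨⟨a, y⟩, hy⟩ ⟨⟨b, z⟩, hz⟩ (⟨hab, hyz⟩ | ⟨hab, hya, hzb⟩)
    · obtain rfl : a = b := hab
      exact Or.inl ⟨rfl, hΘ.adj_smul (cocycle hK g a) y z hyz⟩
    · exact Or.inr ⟨hT.adj_smul g a b hab, (congrArg _ hya).trans (hatt g a b hab).symm,
        (congrArg _ hzb).trans (hatt g b a hab.symm).symm⟩
  · intro y z hyz
    have := congrArg (fun p ↦ p.1.2) hyz
    exact MulAction.injective _ this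
  · intro k y
    have hkv : (k : G) • v = v := (hK k).1 k.2
    refine Subtype.ext (Prod.ext hkv.symm ?_)
    change _ = cocycle hK (k : G) v • _
    simp only [smul_smul]
    congr 1
    ext
    simp [coe_cocycle hK _ hv, hkv]
  · rintro ⟨⟨a, y⟩, hy⟩
    constructor
    · intro ha
      exact ⟨(⟨_, (hK _).2 (transporter_smul hv)⟩ : K) • y,
        Subtype.ext (Prod.ext ha.symm (inv_smul_smul _ _))⟩
    · rintro ⟨z, hz⟩
      exact (congrArg (fun p ↦ p.1.1) hz).symm
  · intro y z
    constructor
    · rintro (⟨-, h⟩ | ⟨h, -⟩)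
      · simpa using hΘ.adj_smul (⟨_, (hK _).2 (transporter_smul hv)⟩ : K) _ _ h
      · exact absurd rfl h.ne
    · exact fun h ↦ Or.inl ⟨rfl, hΘ.adj_smul _ _ _ h⟩
  · rintro ⟨⟨a, y⟩, hy⟩ ⟨⟨b, z⟩, hz⟩ (⟨hab, hyz⟩ | ⟨hab, -⟩)
    · obtain rfl : a = b := hab
      right
      have ha : a ∈ orbit G v := by
        by_contra ha
        exact hyz.ne ((hy.resolve_left ha).trans (hz.resolve_left ha).symm)
      have key : ∀ t : Y, ∀ ht : t ∈ P a, (⟨(a, t), ht⟩ : {p : V × Y // p.2 ∈ P p.1}) =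
          transporter G v a •
            (⟨(v, (⟨_, (hK _).2 (transporter_smul hv)⟩ : K)⁻¹ • t), Or.inl hv⟩ :
              {p : V × Y // p.2 ∈ P p.1}) := by
        intro t ht
        refine Subtype.ext (Prod.ext (transporter_smul ha).symm ?_)
        change t = cocycle hK _ v • _
        rw [smul_smul]
        convert (one_smul K t).symm
        ext
        simp [coe_cocycle hK _ hv, transporter_smul ha]
      exact ⟨transporter G v a, y, z, hyz, key y hy, key z hz⟩
    · exact Or.inl hab

section

variable (B : VertexBlowup G T v K Θ)

theorem proj_incl (y : Y) : B.proj (B.incl y) = v :=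
  (B.proj_eq_iff _).2 ⟨y, rfl⟩

theorem proj_eq_or_adj {a b : B.X} (hab : B.graph.Adj a b) :
    B.proj a = B.proj b ∨ T.Adj (B.proj a) (B.proj b) := by
  rcases B.adj_cases a b hab with h | ⟨g, y, z, -, rfl, rfl⟩
  · exact Or.inr h
  · simp [B.proj_smul, B.proj_incl]

theorem connectedOn_range_incl (hΘ : IsTreeAction K Θ) :
    B.graph.ConnectedOn (Set.range B.incl) := by
  rintro _ ⟨y, rfl⟩ _ ⟨z, rfl⟩
  obtain ⟨p⟩ := hΘ.isTree.connected y z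
  have hp : Θ.ReachableIn Set.univ y z := ⟨p, fun _ _ ↦ trivial⟩
  exact hp.map B.incl (fun x _ ↦ ⟨x, rfl⟩) fun a _ b _ h ↦ Or.inr ((B.adj_incl a b).2 h)

theorem isTreeAction (hT : IsTreeAction G T) (hK : ∀ g : G, g ∈ K ↔ g • v = v)
    (hΘ : IsTreeAction K Θ) : IsTreeAction G B.graph := by
  refine ⟨B.isTree, B.adj_smul, ?_⟩
  rintro g a b hab ⟨hga, hgb⟩
  rcases B.adj_cases a b hab with h | ⟨t, y, z, hyz, rfl, rfl⟩
  · exact hT.noInversion g _ _ h ⟨by rw [← B.proj_smul, hga], by rw [← B.proj_smul, hgb]⟩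
  · have hga' : (t⁻¹ * g * t) • B.incl y = B.incl z := by
      rw [mul_smul, mul_smul, hga, inv_smul_smul]
    have hgb' : (t⁻¹ * g * t) • B.incl z = B.incl y := by
      rw [mul_smul, mul_smul, hgb, inv_smul_smul]
    have hk : t⁻¹ * g * t ∈ K := by
      rw [hK, ← B.proj_incl y, ← B.proj_smul, hga', B.proj_incl, B.proj_incl]
    refine hΘ.noInversion ⟨_, hk⟩ y z hyz ⟨B.incl_injective ?_, B.incl_injective ?_⟩
    · rw [B.incl_smul]
      exact hga'
    · rw [B.incl_smul]
      exact hgb'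

end

/-- If `G` is finitely generated and acts minimally on `T`, then the action of `K` on `Θ` has an
invariant subtree with finitely many orbits. -/
theorem exists_subtree_finite_orbits (B : VertexBlowup G T v K Θ) (hfg : Group.FG G)
    (hT : IsTreeAction G T)
    (hTmin : ∀ N : Set V, N.Nonempty → (∀ g : G, ∀ x ∈ N, g • x ∈ N) → T.ConnectedOn N →
      N = Set.univ)
    (hK : ∀ g : G, g ∈ K ↔ g • v = v) (hΘ : IsTreeAction K Θ) :
    ∃ F D : Set Y, F.Nonempty ∧ (∀ k : K, ∀ y ∈ F, k • y ∈ F) ∧ Θ.ConnectedOn F ∧ D.Finite ∧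
      ∀ y ∈ F, ∃ k : K, ∃ d ∈ D, y = k • d := by
  classical
  have : Nonempty Y := hΘ.isTree.connected.nonempty
  obtain ⟨x₀⟩ := B.isTree.connected.nonempty
  obtain ⟨F, D, ⟨x, hx⟩, hF, hFc, hD, hFD⟩ :=
    (B.isTreeAction hT hK hΘ).exists_subtree_finite_orbits hfg x₀
  have hsurj : B.proj '' F = Set.univ := by
    refine hTmin _ ⟨_, x, hx, rfl⟩ ?_ ?_
    · rintro g _ ⟨y, hy, rfl⟩
      exact ⟨g • y, hF g y hy, B.proj_smul g y⟩
    · rintro _ ⟨y, hy, rfl⟩ _ ⟨z, hz, rfl⟩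
      exact (hFc y hy z hz).map B.proj (fun x hx ↦ ⟨x, hx, rfl⟩)
        fun a _ b _ hab ↦ B.proj_eq_or_adj hab
  obtain ⟨x₁, hx₁, hx₁v⟩ : v ∈ B.proj '' F := hsurj ▸ Set.mem_univ v
  obtain ⟨y₁, rfl⟩ := (B.proj_eq_iff x₁).1 hx₁v
  let s (d : B.X) : Y := if h : ∃ y, ∃ g : G, B.incl y = g • d then h.choose else y₁
  refine ⟨B.incl ⁻¹' F, s '' D, ⟨y₁, hx₁⟩, fun k y hy ↦ ?_, fun y hy z hz ↦ ?_, hD.image s,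
    fun y hy ↦ ?_⟩
  · rw [Set.mem_preimage, B.incl_smul]
    exact hF _ _ hy
  · have hleft := Function.leftInverse_invFun B.incl_injective
    have := (hFc.inter B.isTree.isAcyclic (B.connectedOn_range_incl hΘ) _ ⟨hy, y, rfl⟩ _
      ⟨hz, z, rfl⟩).map (Γ' := Θ) (F' := B.incl ⁻¹' F) (Function.invFun B.incl) ?_ ?_
    · rwa [hleft, hleft] at this
    · rintro _ ⟨hx, y, rfl⟩
      rwa [hleft]
    · rintro _ ⟨-, a, rfl⟩ _ ⟨-, b, rfl⟩ hab
      rw [hleft, hleft]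
      exact Or.inr ((B.adj_incl a b).1 hab)
  · obtain ⟨g, d, hd, hyd⟩ := hFD _ hy
    have hex : ∃ y, ∃ g : G, B.incl y = g • d := ⟨y, g, hyd⟩
    obtain ⟨g', hg'⟩ := hex.choose_spec
    have hsd : s d = hex.choose := dif_pos hex
    rw [← hsd] at hg'
    have hy' : B.incl y = (g * g'⁻¹) • B.incl (s d) := by
      rw [hg', mul_smul, inv_smul_smul, hyd]
    have hk : g * g'⁻¹ ∈ K := by
      rw [hK]
      conv_lhs => rw [← B.proj_incl (s d)]
      rw [← B.proj_smul, ← hy', B.proj_incl]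
    exact ⟨⟨_, hk⟩, s d, ⟨d, hd, rfl⟩, B.incl_injective (by rw [hy', B.incl_smul])⟩

end VertexBlowup

/-- a subgroup of a vertex stabilizer of a universally elliptic tree is
universally elliptic iff it is elliptic in every splitting of the vertex group relative
to the incident edge stabilizers. -/
theorem vertex_subgroup_univ_elliptic {G : Type u} [Group G] (hfg : Group.FG G)
    (𝒜 : Set (Subgroup G)) (h𝒜 : ClosedFamily 𝒜)
    (T : GTree G) (hT : T.IsATree 𝒜) (hTue : T.UnivEllipticTree 𝒜)
    (v : T.V) (H : Subgroup G) (hH : H ≤ T.vertexStab v) :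
    GTree.UnivEllipticSubgroup 𝒜 H ↔
      RelUnivEllipticSubgroup
        {K : Subgroup ↥(T.vertexStab v) | Subgroup.map (T.vertexStab v).subtype K ∈ 𝒜}
        {K : Subgroup ↥(T.vertexStab v) |
          ∃ w : T.V, T.graph.Adj v w ∧ K = (T.edgeStab v w).subgroupOf (T.vertexStab v)}
        (H.subgroupOf (T.vertexStab v)) := by
  have hTa := T.isTreeAction
  have hK : ∀ g : G, g ∈ T.vertexStab v ↔ g • v = v := fun g ↦ Iff.rfl
  constructor
  · intro huniv Y hY
    obtain ⟨B⟩ := VertexBlowup.nonempty hTa hK Y.isTreeAction fun w hw ↦ by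
      obtain ⟨y, hy⟩ := hY.2 _ ⟨w, hw, rfl⟩
      exact ⟨y, fun k hk ↦ hy k ⟨k.2, hk⟩⟩
    have hB := B.isTreeAction hTa hK Y.isTreeAction
    obtain ⟨x₀⟩ := B.isTree.connected.nonempty
    obtain ⟨F, D, hne, hF, hFc, hD, hFD⟩ := hB.exists_subtree_finite_orbits hfg x₀
    obtain ⟨S, j, hj, hjs, hja, -⟩ := GTree.exists_embedding hB hne hF hFc hD hFD
    obtain ⟨x, hx⟩ := huniv S fun a b hab ↦ by
      rcases B.adj_cases _ _ (hja a b hab) with h | ⟨g, y, z, hyz, ha, hb⟩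
      · have hfix : ∀ k : G, ∀ c, S.act k c = c → T.act k (B.proj (j c)) = B.proj (j c) := by
          intro k c hc
          rw [← T.smul_def, ← B.proj_smul, ← hjs, S.smul_def, hc]
        exact h𝒜.2 _ (hT _ _ h) _ fun k hk ↦ ⟨hfix k a hk.1, hfix k b hk.2⟩
      · refine h𝒜.2 _ (h𝒜.1 _ (hY.1 y z hyz) g) _ fun k hk ↦ ?_
        have hfix : ∀ c u, j c = g • B.incl u → S.act k c = c →
            (g⁻¹ * k * g) • B.incl u = B.incl u := by
          intro c u hc hkc
          rw [mul_smul, mul_smul, inv_smul_eq_iff, ← hc, ← hjs, S.smul_def, hkc]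
        have hky := hfix a y ha hk.1
        have hkz := hfix b z hb hk.2
        have hkK : g⁻¹ * k * g ∈ T.vertexStab v := by
          rw [hK, ← B.proj_incl y, ← B.proj_smul, hky]
        refine ⟨g⁻¹ * k * g, ⟨⟨_, hkK⟩, ⟨?_, ?_⟩, rfl⟩, by simp [mul_assoc]⟩
        · exact B.incl_injective ((B.incl_smul _ _).trans hky)
        · exact B.incl_injective ((B.incl_smul _ _).trans hkz)
    obtain ⟨y₀⟩ := Y.nonempty
    obtain ⟨_, ⟨y, rfl⟩, hy⟩ := hB.exists_fixed_mem H (N := Set.range B.incl) ⟨_, y₀, rfl⟩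
      (B.connectedOn_range_incl Y.isTreeAction)
      (by
        rintro h hh _ ⟨y, rfl⟩
        exact ⟨(⟨h, hH hh⟩ : T.vertexStab v) • y, B.incl_smul _ _⟩)
      (z := j x) (fun h hh ↦ by rw [← hjs, S.smul_def, hx h hh])
    exact ⟨y, fun k hk ↦ B.incl_injective ((B.incl_smul k y).trans (hy k hk))⟩
  · intro hrel S hS
    have hSK : IsTreeAction (T.vertexStab v) S.graph :=
      ⟨S.isTreeAction.isTree, fun k ↦ S.act_adj k, fun k ↦ S.noInversion k⟩
    obtain ⟨B⟩ := VertexBlowup.nonempty hTa hK hSK fun w hw ↦ by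
      obtain ⟨y, hy⟩ := hTue v w hw S hS
      exact ⟨y, fun k hk ↦ hy k ⟨k.2, hk⟩⟩
    obtain ⟨F, D, hne, hF, hFc, hD, hFD⟩ := B.exists_subtree_finite_orbits hfg hTa
      (fun N hne hN hNc ↦ T.minimal N hne hN
        (SimpleGraph.induce_connected_iff_connectedOn.2 ⟨hne, hNc⟩)) hK hSK
    obtain ⟨N, j, hj, hjs, hja, hjc⟩ := GTree.exists_embedding hSK hne hF hFc hD hFD
    have hN : RelATree {K : Subgroup ↥(T.vertexStab v) | Subgroup.map (T.vertexStab v).subtype K ∈ 𝒜}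
        {K | ∃ w : T.V, T.graph.Adj v w ∧ K = (T.edgeStab v w).subgroupOf (T.vertexStab v)} N := by
      refine ⟨fun a b hab ↦ ?_, ?_⟩
      · refine h𝒜.2 _ (hS _ _ (hja a b hab)) _ ?_
        rintro _ ⟨k, hk, rfl⟩
        exact ⟨(hjs k a).symm.trans (congrArg j hk.1), (hjs k b).symm.trans (congrArg j hk.2)⟩
      · rintro _ ⟨w, hw, rfl⟩
        obtain ⟨z, hz⟩ := hTue v w hw S hS
        obtain ⟨n⟩ := N.nonempty
        obtain ⟨_, ⟨y, rfl⟩, hy⟩ := hSK.exists_fixed_mem ((T.edgeStab v w).subgroupOf _)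
          (N := Set.range j) ⟨_, n, rfl⟩ hjc
          (by
            rintro k - _ ⟨y, rfl⟩
            exact ⟨k • y, hjs k y⟩)
          (z := z) (fun k hk ↦ hz k hk)
        exact ⟨y, fun k hk ↦ hj ((hjs k y).trans (hy k hk))⟩
    obtain ⟨x, hx⟩ := hrel N hN
    refine ⟨j x, fun h hh ↦ ?_⟩
    have hfix := hx ⟨h, hH hh⟩ hh
    exact (hjs ⟨h, hH hh⟩ x).symm.trans (congrArg j hfix)
end
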